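/- arXiv:2202.08575 — 4 statements merged into one kernel-verified Lean document; each statement's English description precedes it below -/
import Mathlib

section
/- Let N be a Nijenhuis operator on an associative conformal algebra A and define a ∘^N_λ b = N(a)_λ b + a_λ N(b) − N(a_λ b). Then (A, ∘^N_λ) is an associative conformal algebra, and N is an algebra homomorphism from (A, ∘^N_λ) to A, i.e., N(a ∘^N_λ b) = N(a)_λ N(b) for all a, b ∈ A. -/
open Polynomial

noncomputable section

/-!  Framework for associative conformal algebras over `ℂ[∂]`.

A `ℂ[∂]`-module is modelled as a module over `ℂ[X]` (with the variable `X`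
playing the role of `∂`), together with a compatible `ℂ`-action.  A polynomial
`Σᵢ λ^i cᵢ` in a formal variable `λ` with coefficients in a module `V` is
recorded by its finitely supported family of coefficients `ℕ →₀ V`.  Identities
between such polynomials are stated through their evaluations at every
`lam : ℂ`; over the infinite field `ℂ` this is equivalent to the corresponding
polynomial identities. -/

/-- Evaluation at `lam : ℂ` of a `V`-valued polynomial given by its coefficients. -/
def cev {V : Type*} [AddCommMonoid V] [Module ℂ V] (lam : ℂ) (p : ℕ →₀ V) : V :=
  p.sum fun i c => lam ^ i • c

/-- Substitution `μ ↦ -λ - ∂` in the polynomial `μ ↦ Σᵢ μ^i cᵢ`, where `∂ = X`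
acts through the `ℂ[∂]`-module structure. -/
def csub {V : Type*} [AddCommMonoid V] [Module ℂ[X] V] (lam : ℂ) (p : ℕ →₀ V) : V :=
  p.sum fun i c => ((-(C lam) - X) ^ i : ℂ[X]) • c

/-- A `ℂ`-bilinear conformal sesquilinear λ-product `A × B → M[λ]`, recorded by
the coefficient family `coeff a b : ℕ →₀ M` of the polynomial `a_λ b`. -/
structure ConfBilin (A B M : Type*)
    [AddCommGroup A] [Module ℂ A] [Module ℂ[X] A]
    [AddCommGroup B] [Module ℂ B] [Module ℂ[X] B]
    [AddCommGroup M] [Module ℂ M] [Module ℂ[X] M] where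
  coeff : A → B → ℕ →₀ M
  add_left : ∀ a a' b, coeff (a + a') b = coeff a b + coeff a' b
  smul_left : ∀ (c : ℂ) a b, coeff (c • a) b = c • coeff a b
  add_right : ∀ a b b', coeff a (b + b') = coeff a b + coeff a b'
  smul_right : ∀ (c : ℂ) a b, coeff a (c • b) = c • coeff a b
  /-- `(∂a)_λ b = -λ (a_λ b)` -/
  sesq_left : ∀ (lam : ℂ) (a : A) (b : B),
    cev lam (coeff ((X : ℂ[X]) • a) b) = (-lam) • cev lam (coeff a b)
  /-- `a_λ (∂b) = (∂ + λ) (a_λ b)` -/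
  sesq_right : ∀ (lam : ℂ) (a : A) (b : B),
    cev lam (coeff a ((X : ℂ[X]) • b)) =
      (X : ℂ[X]) • cev lam (coeff a b) + lam • cev lam (coeff a b)

namespace ConfBilin

variable {A B M : Type*}
  [AddCommGroup A] [Module ℂ A] [Module ℂ[X] A]
  [AddCommGroup B] [Module ℂ B] [Module ℂ[X] B]
  [AddCommGroup M] [Module ℂ M] [Module ℂ[X] M]

/-- `a_lam b` : the λ-product evaluated at `lam : ℂ`. -/
def mul (f : ConfBilin A B M) (lam : ℂ) (a : A) (b : B) : M := cev lam (f.coeff a b)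

/-- `a_{-λ-∂} b` : the λ-product with `-λ-∂` substituted for the variable. -/
def mulNeg (f : ConfBilin A B M) (lam : ℂ) (a : A) (b : B) : M := csub lam (f.coeff a b)

end ConfBilin

/-- An associative conformal algebra structure on the `ℂ[∂]`-module `A`. -/
structure AssocConfAlg (A : Type*)
    [AddCommGroup A] [Module ℂ A] [Module ℂ[X] A] extends ConfBilin A A A where
  /-- `(a_λ b)_{λ+μ} c = a_λ (b_μ c)` -/
  assoc : ∀ (lam mu : ℂ) (a b c : A),
    toConfBilin.mul (lam + mu) (toConfBilin.mul lam a b) c =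
      toConfBilin.mul lam a (toConfBilin.mul mu b c)

namespace AssocConfAlg

variable {A : Type*} [AddCommGroup A] [Module ℂ A] [Module ℂ[X] A]

def mul (θ : AssocConfAlg A) : ℂ → A → A → A := θ.toConfBilin.mul

def mulNeg (θ : AssocConfAlg A) : ℂ → A → A → A := θ.toConfBilin.mulNeg

end AssocConfAlg

/-- A conformal bimodule `M` over the associative conformal algebra `(A, θ)`,
with left action `l` and right action `r`. -/
structure ConfBimod {A : Type*} [AddCommGroup A] [Module ℂ A] [Module ℂ[X] A]
    (θ : AssocConfAlg A) (M : Type*)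
    [AddCommGroup M] [Module ℂ M] [Module ℂ[X] M] where
  l : ConfBilin A M M
  r : ConfBilin M A M
  /-- `(a_λ b)_{λ+μ} m = a_λ (b_μ m)` -/
  assoc_ll : ∀ (lam mu : ℂ) (a b : A) (m : M),
    l.mul (lam + mu) (θ.mul lam a b) m = l.mul lam a (l.mul mu b m)
  /-- `(m_λ a)_{λ+μ} b = m_λ (a_μ b)` -/
  assoc_rr : ∀ (lam mu : ℂ) (m : M) (a b : A),
    r.mul (lam + mu) (r.mul lam m a) b = r.mul lam m (θ.mul mu a b)
  /-- `(a_λ m)_{λ+μ} b = a_λ (m_μ b)` -/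
  assoc_lr : ∀ (lam mu : ℂ) (a : A) (m : M) (b : A),
    r.mul (lam + mu) (l.mul lam a m) b = l.mul lam a (r.mul mu m b)

section Defs

variable {A M : Type*}
  [AddCommGroup A] [Module ℂ A] [Module ℂ[X] A]
  [AddCommGroup M] [Module ℂ M] [Module ℂ[X] M]

/-- `T : M → A` is an `𝒪`-operator on `(A, θ)` with respect to the conformal
bimodule `ρ` : `T(m)_λ T(n) = T (T(m)_λ n + m_λ T(n))`. -/
def IsOOperator {θ : AssocConfAlg A} (ρ : ConfBimod θ M) (T : M → A) : Prop :=
  ∀ (lam : ℂ) (m n : M),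
    θ.mul lam (T m) (T n) = T (ρ.l.mul lam (T m) n + ρ.r.mul lam m (T n))

/-- `N : A → A` is a Nijenhuis operator :
`N(a)_λ N(b) = N (N(a)_λ b + a_λ N(b) - N(a_λ b))`. -/
def IsNijenhuis (θ : AssocConfAlg A) (N : A → A) : Prop :=
  ∀ (lam : ℂ) (a b : A),
    θ.mul lam (N a) (N b) =
      N (θ.mul lam (N a) b + θ.mul lam a (N b) - N (θ.mul lam a b))

/-- `T : A → A` is a Rota-Baxter operator of weight `q`. -/
def IsRotaBaxterWt (θ : AssocConfAlg A) (q : ℂ) (T : A → A) : Prop :=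
  ∀ (lam : ℂ) (a b : A),
    θ.mul lam (T a) (T b) =
      T (θ.mul lam (T a) b + θ.mul lam a (T b) + q • θ.mul lam a b)

/-- The Hochschild 2-cocycle identity for an `M`-valued λ-bilinear map `ψ` on `A`. -/
def IsTwoCocycleFun {θ : AssocConfAlg A} (ρ : ConfBimod θ M)
    (ψ : ℂ → A → A → M) : Prop :=
  ∀ (lam mu : ℂ) (a b c : A),
    ρ.l.mul lam a (ψ mu b c) - ψ (lam + mu) (θ.mul lam a b) c
      + ψ lam a (θ.mul mu b c) - ρ.r.mul (lam + mu) (ψ lam a b) c = 0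

/-- `φ` is a 2-cocycle in `C²(A, M)`. -/
def IsTwoCocycle {θ : AssocConfAlg A} (ρ : ConfBimod θ M)
    (φ : ConfBilin A A M) : Prop :=
  IsTwoCocycleFun ρ φ.mul

/-- `T : M → A` is a `φ`-twisted Rota-Baxter operator :
`T(m)_λ T(n) = T (T(m)_λ n + m_λ T(n) + φ_λ(T(m), T(n)))`. -/
def IsTwistedRB {θ : AssocConfAlg A} (ρ : ConfBimod θ M) (φ : ConfBilin A A M)
    (T : M → A) : Prop :=
  ∀ (lam : ℂ) (m n : M),
    θ.mul lam (T m) (T n) =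
      T (ρ.l.mul lam (T m) n + ρ.r.mul lam m (T n) + φ.mul lam (T m) (T n))

/-- The λ-product of the semidirect product `A ⊕₀ M`. -/
def sdMul {θ : AssocConfAlg A} (ρ : ConfBimod θ M) (lam : ℂ) (x y : A × M) : A × M :=
  (θ.mul lam x.1 y.1, ρ.l.mul lam x.1 y.2 + ρ.r.mul lam x.2 y.1)

/-- The λ-product of the twisted semidirect product `A ⊕_ψ M`. -/
def sdMulTw {θ : AssocConfAlg A} (ρ : ConfBimod θ M) (ψ : ℂ → A → A → M)
    (lam : ℂ) (x y : A × M) : A × M :=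
  (θ.mul lam x.1 y.1, ρ.l.mul lam x.1 y.2 + ρ.r.mul lam x.2 y.1 + ψ lam x.1 y.1)

/-- The lift `T̂(a, m) = (T(m), 0)` of a map `T : M → A` to `A ⊕ M`. -/
def liftMap (T : M → A) (x : A × M) : A × M := (T x.2, 0)

/-- The λ-product `m ⋆_λ n = T(m)_λ n + m_λ T(n)` on `M` induced by an `𝒪`-operator. -/
def oStar {θ : AssocConfAlg A} (ρ : ConfBimod θ M) (T : M → A)
    (lam : ℂ) (m n : M) : M :=
  ρ.l.mul lam (T m) n + ρ.r.mul lam m (T n)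

/-- The left λ-action `m ·_λ a = T(m)_λ a - T(m_λ a)` of `M_ass` on `A`. -/
def oDotL {θ : AssocConfAlg A} (ρ : ConfBimod θ M) (T : M → A)
    (lam : ℂ) (m : M) (a : A) : A :=
  θ.mul lam (T m) a - T (ρ.r.mul lam m a)

/-- The right λ-action `a ·_λ m = a_λ T(m) - T(a_λ m)` of `M_ass` on `A`. -/
def oDotR {θ : AssocConfAlg A} (ρ : ConfBimod θ M) (T : M → A)
    (lam : ℂ) (a : A) (m : M) : A :=
  θ.mul lam a (T m) - T (ρ.l.mul lam a m)

/-- `m ⋆^φ_λ n = T(m)_λ n + m_λ T(n) + φ_λ(T(m), T(n))`. -/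
def twStar {θ : AssocConfAlg A} (ρ : ConfBimod θ M) (φ : ConfBilin A A M)
    (T : M → A) (lam : ℂ) (m n : M) : M :=
  ρ.l.mul lam (T m) n + ρ.r.mul lam m (T n) + φ.mul lam (T m) (T n)

/-- `m ·^φ_λ a = T(m)_λ a - T (m_λ a + φ_λ(T(m), a))`. -/
def twDotL {θ : AssocConfAlg A} (ρ : ConfBimod θ M) (φ : ConfBilin A A M)
    (T : M → A) (lam : ℂ) (m : M) (a : A) : A :=
  θ.mul lam (T m) a - T (ρ.r.mul lam m a + φ.mul lam (T m) a)

/-- `a ·^φ_λ m = a_λ T(m) - T (a_λ m + φ_λ(a, T(m)))`. -/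
def twDotR {θ : AssocConfAlg A} (ρ : ConfBimod θ M) (φ : ConfBilin A A M)
    (T : M → A) (lam : ℂ) (a : A) (m : M) : A :=
  θ.mul lam a (T m) - T (ρ.l.mul lam a m + φ.mul lam a (T m))

/-- The map `(a, m) ↦ (a, m - h(a))` on `A ⊕ M`. -/
def shiftMap (h : A → M) (p : A × M) : A × M := (p.1, p.2 - h p.1)

/-- The deformed λ-product `a ∘^N_λ b = N(a)_λ b + a_λ N(b) - N(a_λ b)`. -/
def nijProd (θ : AssocConfAlg A) (N : A → A) (lam : ℂ) (a b : A) : A :=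
  θ.mul lam (N a) b + θ.mul lam a (N b) - N (θ.mul lam a b)

end Defs

/-- A dendriform conformal algebra. -/
structure DendriformConfAlg (E : Type*)
    [AddCommGroup E] [Module ℂ E] [Module ℂ[X] E] where
  succ : ConfBilin E E E
  prec : ConfBilin E E E
  dend1 : ∀ (lam mu : ℂ) (a b c : E),
    succ.mul lam a (succ.mul mu b c) =
      succ.mul (lam + mu) (succ.mul lam a b + prec.mul lam a b) c
  dend2 : ∀ (lam mu : ℂ) (a b c : E),
    prec.mul (lam + mu) (prec.mul lam a b) c =
      prec.mul lam a (succ.mul mu b c + prec.mul mu b c)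
  dend3 : ∀ (lam mu : ℂ) (a b c : E),
    prec.mul (lam + mu) (succ.mul lam a b) c = succ.mul lam a (prec.mul mu b c)

/-- The product `a ∘_λ b = a ≻_λ b - b ≺_{-λ-∂} a` of a dendriform conformal algebra. -/
def dendComp {E : Type*} [AddCommGroup E] [Module ℂ E] [Module ℂ[X] E]
    (D : DendriformConfAlg E) (lam : ℂ) (a b : E) : E :=
  D.succ.mul lam a b - D.prec.mulNeg lam b a

/-- A conformal NS-algebra. -/
structure NSConfAlg (E : Type*)
    [AddCommGroup E] [Module ℂ E] [Module ℂ[X] E] where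
  succ : ConfBilin E E E
  prec : ConfBilin E E E
  vee : ConfBilin E E E
  ns1 : ∀ (lam mu : ℂ) (x y z : E),
    succ.mul lam x (succ.mul mu y z) =
      succ.mul (lam + mu) (succ.mul lam x y + prec.mul lam x y + vee.mul lam x y) z
  ns2 : ∀ (lam mu : ℂ) (x y z : E),
    prec.mul lam x (succ.mul mu y z + prec.mul mu y z + vee.mul mu y z) =
      prec.mul (lam + mu) (prec.mul lam x y) z
  ns3 : ∀ (lam mu : ℂ) (x y z : E),
    succ.mul lam x (prec.mul mu y z) = prec.mul (lam + mu) (succ.mul lam x y) z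
  ns4 : ∀ (lam mu : ℂ) (x y z : E),
    succ.mul lam x (vee.mul mu y z)
        - vee.mul (lam + mu) (succ.mul lam x y + prec.mul lam x y + vee.mul lam x y) z =
      prec.mul (lam + mu) (vee.mul lam x y) z
        - vee.mul lam x (succ.mul mu y z + prec.mul mu y z + vee.mul mu y z)

/-- `x ×_λ y = x ≻_λ y + x ≺_λ y + x ∨_λ y` in a conformal NS-algebra. -/
def nsTimes {E : Type*} [AddCommGroup E] [Module ℂ E] [Module ℂ[X] E]
    (NS : NSConfAlg E) (lam : ℂ) (x y : E) : E :=
  NS.succ.mul lam x y + NS.prec.mul lam x y + NS.vee.mul lam x y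

theorem stmt15_cev_add {V : Type*} [AddCommMonoid V] [Module ℂ V] (lam : ℂ) (p q : ℕ →₀ V) :
    cev lam (p + q) = cev lam p + cev lam q := by
  unfold cev
  exact Finsupp.sum_add_index' (fun i => smul_zero _) (fun i x y => smul_add _ x y)

theorem stmt15_add_left {A : Type*} [AddCommGroup A] [Module ℂ A] [Module ℂ[X] A]
    (θ : AssocConfAlg A) (lam : ℂ) (a b c : A) :
    θ.mul lam (a + b) c = θ.mul lam a c + θ.mul lam b c := by
  simp only [AssocConfAlg.mul, ConfBilin.mul, θ.add_left, stmt15_cev_add]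

theorem stmt15_add_right {A : Type*} [AddCommGroup A] [Module ℂ A] [Module ℂ[X] A]
    (θ : AssocConfAlg A) (lam : ℂ) (a b c : A) :
    θ.mul lam a (b + c) = θ.mul lam a b + θ.mul lam a c := by
  simp only [AssocConfAlg.mul, ConfBilin.mul, θ.add_right, stmt15_cev_add]

theorem stmt15_sub_left {A : Type*} [AddCommGroup A] [Module ℂ A] [Module ℂ[X] A]
    (θ : AssocConfAlg A) (lam : ℂ) (a b c : A) :
    θ.mul lam (a - b) c = θ.mul lam a c - θ.mul lam b c := by
  rw [eq_sub_iff_add_eq, ← stmt15_add_left, sub_add_cancel]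

theorem stmt15_sub_right {A : Type*} [AddCommGroup A] [Module ℂ A] [Module ℂ[X] A]
    (θ : AssocConfAlg A) (lam : ℂ) (a b c : A) :
    θ.mul lam a (b - c) = θ.mul lam a b - θ.mul lam a c := by
  rw [eq_sub_iff_add_eq, ← stmt15_add_right, sub_add_cancel]

/-- for a Nijenhuis operator `N`, the deformed product
`a ∘^N_λ b = N(a)_λ b + a_λ N(b) - N(a_λ b)` is conformal sesquilinear and
associative, and `N` is an algebra homomorphism from `(A, ∘^N)` to `A`. -/
theorem stmt15 {A : Type*}
    [AddCommGroup A] [Module ℂ A] [Module ℂ[X] A] [IsScalarTower ℂ ℂ[X] A]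
    (θ : AssocConfAlg A) (N : A →ₗ[ℂ[X]] A) (hN : IsNijenhuis θ ⇑N) :
    (∀ (lam : ℂ) (a b : A),
        nijProd θ (⇑N) lam ((X : ℂ[X]) • a) b = (-lam) • nijProd θ (⇑N) lam a b) ∧
    (∀ (lam : ℂ) (a b : A),
        nijProd θ (⇑N) lam a ((X : ℂ[X]) • b) =
          (X : ℂ[X]) • nijProd θ (⇑N) lam a b + lam • nijProd θ (⇑N) lam a b) ∧
    (∀ (lam mu : ℂ) (a b c : A),
        nijProd θ (⇑N) (lam + mu) (nijProd θ (⇑N) lam a b) c =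
          nijProd θ (⇑N) lam a (nijProd θ (⇑N) mu b c)) ∧
    (∀ (lam : ℂ) (a b : A), N (nijProd θ (⇑N) lam a b) = θ.mul lam (N a) (N b)) := by
  have hl : ∀ (lam : ℂ) (a b : A), θ.mul lam ((X : ℂ[X]) • a) b = (-lam) • θ.mul lam a b :=
    θ.sesq_left
  have hr : ∀ (lam : ℂ) (a b : A), θ.mul lam a ((X : ℂ[X]) • b) =
      (X : ℂ[X]) • θ.mul lam a b + lam • θ.mul lam a b := θ.sesq_right
  have has : ∀ (lam mu : ℂ) (a b c : A), θ.mul (lam + mu) (θ.mul lam a b) c =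
      θ.mul lam a (θ.mul mu b c) := θ.assoc
  have hs : ∀ (z : ℂ) (a : A), N (z • a) = z • N a := by
    intro z a
    rw [← algebraMap_smul ℂ[X] z a, map_smul, algebraMap_smul]
  have hh : ∀ (lam : ℂ) (a b : A), N (nijProd θ (⇑N) lam a b) = θ.mul lam (N a) (N b) :=
    fun lam a b => (hN lam a b).symm
  refine ⟨?_, ?_, ?_, hh⟩
  · intro lam a b
    simp only [nijProd, map_smul, hl, hs, smul_add, smul_sub]
  · intro lam a b
    simp only [nijProd, map_smul, map_add, hr, hs, smul_add, smul_sub]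
    abel
  · intro lam mu a b c
    have e1 : nijProd θ (⇑N) (lam + mu) (nijProd θ (⇑N) lam a b) c =
        θ.mul (lam + mu) (N (nijProd θ (⇑N) lam a b)) c
        + θ.mul (lam + mu) (nijProd θ (⇑N) lam a b) (N c)
        - N (θ.mul (lam + mu) (nijProd θ (⇑N) lam a b) c) := rfl
    have e2 : nijProd θ (⇑N) lam a (nijProd θ (⇑N) mu b c) =
        θ.mul lam (N a) (nijProd θ (⇑N) mu b c)
        + θ.mul lam a (N (nijProd θ (⇑N) mu b c))
        - N (θ.mul lam a (nijProd θ (⇑N) mu b c)) := rfl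
    have h1 := hN (lam + mu) (θ.mul lam a b) c
    have h2 := hN lam a (θ.mul mu b c)
    rw [e1, e2, hh, hh]
    simp only [nijProd, stmt15_add_left, stmt15_add_right, stmt15_sub_left, stmt15_sub_right,
      map_add, map_sub, has] at h1 h2 ⊢
    rw [h1, h2]
    abel
end
end

section
/- Let N be a Nijenhuis operator on an associative conformal algebra A. Then for all a, b ∈ A and all nonnegative integers j, k: N^j(a)_λ N^k(b) − N^k(N^j(a)_λ b) − N^j(a_λ N^k(b)) + N^{j+k}(a_λ b) = 0. -/
open Polynomial

noncomputable section

/-- for a Nijenhuis operator `N` and all `j, k ≥ 0`,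
`N^j(a)_λ N^k(b) - N^k(N^j(a)_λ b) - N^j(a_λ N^k(b)) + N^{j+k}(a_λ b) = 0`. -/
theorem stmt16 {A : Type*}
    [AddCommGroup A] [Module ℂ A] [Module ℂ[X] A] [IsScalarTower ℂ ℂ[X] A]
    (θ : AssocConfAlg A) (N : A →ₗ[ℂ[X]] A) (hN : IsNijenhuis θ ⇑N) :
    ∀ (lam : ℂ) (a b : A) (j k : ℕ),
      θ.mul lam ((N ^ j) a) ((N ^ k) b) - (N ^ k) (θ.mul lam ((N ^ j) a) b)
        - (N ^ j) (θ.mul lam a ((N ^ k) b)) + (N ^ (j + k)) (θ.mul lam a b) = 0 := by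
  intro lam a b j k
  have hs : ∀ (n : ℕ) (x : A), (N ^ (n + 1)) x = N ((N ^ n) x) := by
    intro n x
    rw [pow_succ', Module.End.mul_apply]
  have hc : ∀ (n : ℕ) (x : A), (N ^ n) (N x) = N ((N ^ n) x) := by
    intro n x
    rw [← hs, pow_succ, Module.End.mul_apply]
  have h1 : ∀ (k : ℕ) (a b : A), θ.mul lam (N a) ((N ^ k) b) =
      (N ^ k) (θ.mul lam (N a) b) + N (θ.mul lam a ((N ^ k) b))
        - N ((N ^ k) (θ.mul lam a b)) := by
    intro k a b
    induction k with
    | zero => simp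
    | succ k ih =>
      simp only [hs]
      rw [hN lam a ((N ^ k) b), ih]
      simp only [map_add, map_sub]
      abel
  have h2 : θ.mul lam ((N ^ j) a) ((N ^ k) b) = (N ^ k) (θ.mul lam ((N ^ j) a) b)
        + (N ^ j) (θ.mul lam a ((N ^ k) b)) - (N ^ (j + k)) (θ.mul lam a b) := by
    induction j with
    | zero => simp
    | succ j ih =>
      have e : j + 1 + k = (j + k) + 1 := by omega
      rw [e]
      simp only [hs]
      rw [h1, ih]
      simp only [map_add, map_sub]
      abel
  rw [h2]
  abel
end
end

section
/- Let N be a Nijenhuis operator on an associative conformal algebra A. Then for any polynomial P(z) = Σᵢ₌₀ⁿ cᵢ zⁱ with complex coefficients cᵢ, the operator P(N) = Σᵢ₌₀ⁿ cᵢ Nⁱ is also a Nijenhuis operator on A. -/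
open Polynomial

noncomputable section

/-- The mixed Nijenhuis identity for two operators. -/
def MixNij {A : Type*} [AddCommGroup A] [Module ℂ A] (m : A →ₗ[ℂ] A →ₗ[ℂ] A)
    (P Q : A →ₗ[ℂ] A) : Prop :=
  ∀ a b, m (P a) (Q b) = P (m a (Q b)) + Q (m (P a) b) - P (Q (m a b))

theorem MixNij.flip {A : Type*} [AddCommGroup A] [Module ℂ A] {m : A →ₗ[ℂ] A →ₗ[ℂ] A}
    {P Q : A →ₗ[ℂ] A} (hc : Commute P Q) (h : MixNij m P Q) : MixNij m.flip Q P := by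
  intro a b
  have hc' : ∀ x, P (Q x) = Q (P x) := fun x => LinearMap.congr_fun hc.eq x
  simp only [LinearMap.flip_apply]
  rw [h b a, hc']
  abel

theorem MixNij.pow {A : Type*} [AddCommGroup A] [Module ℂ A] {m : A →ₗ[ℂ] A →ₗ[ℂ] A}
    {P Q : A →ₗ[ℂ] A} (hc : Commute P Q) (h : MixNij m P Q) (i : ℕ) :
    MixNij m P (Q ^ i) := by
  have hc' : ∀ x, P (Q x) = Q (P x) := fun x => LinearMap.congr_fun hc.eq x
  induction i with
  | zero => intro a b; simp
  | succ i ih =>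
    intro a b
    simp only [pow_succ', Module.End.mul_apply]
    rw [h, ih]
    simp only [map_add, map_sub, hc']
    abel

theorem MixNij.poly {A : Type*} [AddCommGroup A] [Module ℂ A] {m : A →ₗ[ℂ] A →ₗ[ℂ] A}
    {P Q : A →ₗ[ℂ] A} (hc : Commute P Q) (h : MixNij m P Q) (n : ℕ) (c : ℕ → ℂ) :
    MixNij m P (∑ i ∈ Finset.range n, c i • Q ^ i) := by
  intro a b
  simp only [LinearMap.sum_apply, LinearMap.smul_apply, map_sum, map_smul]
  rw [← Finset.sum_add_distrib, ← Finset.sum_sub_distrib]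
  refine Finset.sum_congr rfl fun i _ => ?_
  rw [h.pow hc i a b, smul_sub, smul_add]

theorem cev_add' {V : Type*} [AddCommGroup V] [Module ℂ V] (lam : ℂ) (p q : ℕ →₀ V) :
    cev lam (p + q) = cev lam p + cev lam q :=
  Finsupp.sum_add_index' (by simp) (by simp)

theorem cev_smul' {V : Type*} [AddCommGroup V] [Module ℂ V] (lam c : ℂ) (p : ℕ →₀ V) :
    cev lam (c • p) = c • cev lam p := by
  unfold cev
  rw [Finsupp.sum_smul_index' (by simp), Finsupp.smul_sum]
  simp only [smul_comm c]

/-- for a Nijenhuis operator `N` and any polynomial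
`P(z) = Σ_{i=0}^n cᵢ zⁱ`, the operator `P(N) = Σ_{i=0}^n cᵢ Nⁱ` is again a
Nijenhuis operator. -/
theorem stmt17 {A : Type*}
    [AddCommGroup A] [Module ℂ A] [Module ℂ[X] A] [IsScalarTower ℂ ℂ[X] A]
    (θ : AssocConfAlg A) (N : A →ₗ[ℂ[X]] A) (hN : IsNijenhuis θ ⇑N)
    (n : ℕ) (c : ℕ → ℂ) :
    IsNijenhuis θ (fun a => ∑ i ∈ Finset.range (n + 1), c i • (N ^ i) a) := by
  intro lam
  let m : A →ₗ[ℂ] A →ₗ[ℂ] A := LinearMap.mk₂ ℂ (θ.mul lam)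
    (fun a a' b => by
      simp only [AssocConfAlg.mul, ConfBilin.mul, θ.add_left, cev_add'])
    (fun c a b => by
      simp only [AssocConfAlg.mul, ConfBilin.mul, θ.smul_left, cev_smul'])
    (fun a b b' => by
      simp only [AssocConfAlg.mul, ConfBilin.mul, θ.add_right, cev_add'])
    (fun c a b => by
      simp only [AssocConfAlg.mul, ConfBilin.mul, θ.smul_right, cev_smul'])
  let N' : A →ₗ[ℂ] A :=
    { toFun := N
      map_add' := N.map_add
      map_smul' := fun c x => by
        have := N.map_smul (algebraMap ℂ ℂ[X] c) x
        simpa only [algebraMap_smul, RingHom.id_apply] using this }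
  have hpow : ∀ i x, (N' ^ i) x = (N ^ i) x := by
    intro i
    induction i with
    | zero => intro x; rfl
    | succ i ih =>
      intro x
      rw [pow_succ', pow_succ', Module.End.mul_apply, Module.End.mul_apply, ih]
      rfl
  have h0 : MixNij m N' N' := by
    intro a b
    have := hN lam a b
    rw [map_sub, map_add, add_comm] at this
    exact this
  have hc0 : Commute N' N' := Commute.refl _
  let P : A →ₗ[ℂ] A := ∑ i ∈ Finset.range (n + 1), c i • N' ^ i
  have hc1 : Commute N' P :=
    Commute.sum_right _ _ _ fun i _ => ((Commute.refl N').pow_right i).smul_right (c i)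
  have h1 : MixNij m N' P := h0.poly hc0 (n + 1) c
  have h2 : MixNij m.flip P P := (h1.flip hc1).poly hc1.symm (n + 1) c
  have hP : (fun a => ∑ i ∈ Finset.range (n + 1), c i • (N ^ i) a) = ⇑P := by
    funext x
    simp only [P, LinearMap.sum_apply, LinearMap.smul_apply, hpow]
  rw [hP]
  intro a b
  have h3 := h2.flip (Commute.refl P) a b
  rw [map_sub, map_add, add_comm]
  exact h3
end
end

section
/- Let N be a Nijenhuis operator on an associative conformal algebra A, and for each nonnegative integer i define a ∘^{Nⁱ}_λ b = Nⁱ(a)_λ b + a_λ Nⁱ(b) − Nⁱ(a_λ b). Then for all a, b ∈ A and all nonnegative integers i, k: (1) N^k(a) ∘^{Nⁱ}_λ b + a ∘^{Nⁱ}_λ N^k(b) − N^k(a ∘^{Nⁱ}_λ b) = a ∘^{N^{i+k}}_λ b; and (2) N^k is a Nijenhuis operator on the associative conformal algebra (A, ∘^{Nⁱ}_λ), i.e., N^k(a) ∘^{Nⁱ}_λ N^k(b) = N^k(N^k(a) ∘^{Nⁱ}_λ b + a ∘^{Nⁱ}_λ N^k(b) − N^k(a ∘^{Nⁱ}_λ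 b)). -/
open Polynomial

noncomputable section

theorem nij_aux1 {A : Type*}
    [AddCommGroup A] [Module ℂ A] [Module ℂ[X] A]
    (θ : AssocConfAlg A) (N : A →ₗ[ℂ[X]] A) (hN : IsNijenhuis θ ⇑N) (j : ℕ) (lam : ℂ) (a b : A) :
    θ.mul lam ((N ^ j) a) (N b) = (N ^ j) (θ.mul lam a (N b)) + N (θ.mul lam ((N ^ j) a) b)
      - (N ^ j) (N (θ.mul lam a b)) := by
  induction j with
  | zero => simp
  | succ j ih =>
    simp only [pow_succ', Module.End.mul_apply]
    rw [hN lam ((N ^ j) a) b, ih]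
    simp only [map_add, map_sub]
    abel

theorem nij_aux2 {A : Type*}
    [AddCommGroup A] [Module ℂ A] [Module ℂ[X] A]
    (θ : AssocConfAlg A) (N : A →ₗ[ℂ[X]] A) (hN : IsNijenhuis θ ⇑N) (j k : ℕ) (lam : ℂ) (a b : A) :
    θ.mul lam ((N ^ j) a) ((N ^ k) b) = (N ^ j) (θ.mul lam a ((N ^ k) b))
      + (N ^ k) (θ.mul lam ((N ^ j) a) b) - (N ^ (j + k)) (θ.mul lam a b) := by
  induction k with
  | zero => simp
  | succ k ih =>
    have hc : ∀ x, (N ^ j) (N x) = N ((N ^ j) x) := fun x => by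
      rw [← Module.End.mul_apply, ← Module.End.mul_apply, ← pow_succ, ← pow_succ']
    rw [← add_assoc]
    simp only [pow_succ', Module.End.mul_apply]
    rw [nij_aux1 θ N hN j lam a ((N ^ k) b), ih, hc (θ.mul lam a ((N ^ k) b))]
    simp only [map_add, map_sub]
    abel

/-- for a Nijenhuis operator `N` and all `i, k ≥ 0`:
(1) `N^k(a) ∘^{Nⁱ}_λ b + a ∘^{Nⁱ}_λ N^k(b) - N^k(a ∘^{Nⁱ}_λ b) = a ∘^{N^{i+k}}_λ b`;
(2) `N^k` is a Nijenhuis operator on `(A, ∘^{Nⁱ}_λ)`. -/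
theorem stmt18 {A : Type*}
    [AddCommGroup A] [Module ℂ A] [Module ℂ[X] A] [IsScalarTower ℂ ℂ[X] A]
    (θ : AssocConfAlg A) (N : A →ₗ[ℂ[X]] A) (hN : IsNijenhuis θ ⇑N) :
    (∀ (i k : ℕ) (lam : ℂ) (a b : A),
      nijProd θ (⇑(N ^ i)) lam ((N ^ k) a) b + nijProd θ (⇑(N ^ i)) lam a ((N ^ k) b)
          - (N ^ k) (nijProd θ (⇑(N ^ i)) lam a b) =
        nijProd θ (⇑(N ^ (i + k))) lam a b) ∧
    (∀ (i k : ℕ) (lam : ℂ) (a b : A),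
      nijProd θ (⇑(N ^ i)) lam ((N ^ k) a) ((N ^ k) b) =
        (N ^ k) (nijProd θ (⇑(N ^ i)) lam ((N ^ k) a) b
          + nijProd θ (⇑(N ^ i)) lam a ((N ^ k) b)
          - (N ^ k) (nijProd θ (⇑(N ^ i)) lam a b))) := by
  have hp : ∀ (m n : ℕ) (x : A), (N ^ m) ((N ^ n) x) = (N ^ (m + n)) x := fun m n x => by
    rw [pow_add, Module.End.mul_apply]
  have key := nij_aux2 θ N hN
  have h1 : ∀ (i k : ℕ) (lam : ℂ) (a b : A),
      nijProd θ (⇑(N ^ i)) lam ((N ^ k) a) b + nijProd θ (⇑(N ^ i)) lam a ((N ^ k) b)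
          - (N ^ k) (nijProd θ (⇑(N ^ i)) lam a b) =
        nijProd θ (⇑(N ^ (i + k))) lam a b := by
    intro i k lam a b
    simp only [nijProd, hp]
    rw [key k i, key i k, add_comm k i]
    simp only [map_add, map_sub, hp]
    rw [add_comm k i]
    abel
  refine ⟨h1, fun i k lam a b => ?_⟩
  rw [h1]
  simp only [nijProd, hp]
  rw [key (i + k) k, key k (i + k), key k k]
  simp only [map_add, map_sub, hp]
  rw [show k + (i + k) = i + k + k by omega, show i + (k + k) = i + k + k by omega]
  abel
end
end
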